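/- For any 0 < τ < σ ≤ 1 and any ε ≤ τ, setting w^{σ,τ}_ε := min{ (u_ε − q ln(1/σ))₊ / (q ln(σ/τ)), 1 } ∈ H¹₀(Ω), one has the identity ln(σ/τ) · ∫_Ω q² (K_H(x)∇w^{σ,τ}_ε | ∇w^{σ,τ}_ε) dx = ε^{-2} ∫_Ω (u_ε − q ln(1/ε))₊^p q dx; moreover w^{σ,τ}_ε ≡ 1 on A_ε^τ := {x ∈ Ω : u_ε(x) > q(x) ln(1/τ)} and supp(w^{σ,τ}_ε) is the closure of A_ε^σ := {x ∈ Ω : u_ε(x) > q(x) ln(1/σ)}. -/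

import Mathlib

open MeasureTheory Real Filter Topology Set

noncomputable section

/-- The bilinear form `(K_H(x) a | b)` associated with the matrix
`K_H(x) = (k²+|x|²)⁻¹ [[k²+x₂², -x₁x₂],[-x₁x₂, k²+x₁²]]`. -/
def KHform (k : ℝ) (x a b : ℝ × ℝ) : ℝ :=
  (k ^ 2 + x.1 ^ 2 + x.2 ^ 2)⁻¹ *
    ((k ^ 2 + x.2 ^ 2) * a.1 * b.1 - x.1 * x.2 * a.1 * b.2
      - x.1 * x.2 * a.2 * b.1 + (k ^ 2 + x.1 ^ 2) * a.2 * b.2)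

/-- `K_H(x)` applied to a vector `a`. -/
def KHvec (k : ℝ) (x a : ℝ × ℝ) : ℝ × ℝ :=
  ((k ^ 2 + x.1 ^ 2 + x.2 ^ 2)⁻¹ * ((k ^ 2 + x.2 ^ 2) * a.1 - x.1 * x.2 * a.2),
   (k ^ 2 + x.1 ^ 2 + x.2 ^ 2)⁻¹ * (-(x.1 * x.2) * a.1 + (k ^ 2 + x.1 ^ 2) * a.2))

/-- `det K_H(x) = k²/(k²+|x|²)`. -/
def detKH (k : ℝ) (x : ℝ × ℝ) : ℝ := k ^ 2 / (k ^ 2 + x.1 ^ 2 + x.2 ^ 2)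

/-- Gradient of a scalar function on `ℝ²`. -/
def grad (u : ℝ × ℝ → ℝ) (x : ℝ × ℝ) : ℝ × ℝ :=
  (fderiv ℝ u x (1, 0), fderiv ℝ u x (0, 1))

/-- Divergence of a vector field on `ℝ²`. -/
def div2 (F : ℝ × ℝ → ℝ × ℝ) (x : ℝ × ℝ) : ℝ :=
  fderiv ℝ (fun y => (F y).1) x (1, 0) + fderiv ℝ (fun y => (F y).2) x (0, 1)

/-- The operator `L_H u = -div (K_H(x) ∇u)`. -/
def LH (k : ℝ) (u : ℝ × ℝ → ℝ) (x : ℝ × ℝ) : ℝ :=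
  - div2 (fun y => KHvec k y (grad u y)) x

/-- Positive part `t₊ = max (t, 0)`. -/
def pPart (t : ℝ) : ℝ := max t 0

/-- Clockwise rotation through `π/2`: `a^⊥`. -/
def perp2 (a : ℝ × ℝ) : ℝ × ℝ := (a.2, -a.1)

/-- Euclidean distance in the plane. -/
def dE (a b : ℝ × ℝ) : ℝ := Real.sqrt ((a.1 - b.1) ^ 2 + (a.2 - b.2) ^ 2)

/-- Euclidean diameter of a planar set. -/
def diamE (S : Set (ℝ × ℝ)) : ℝ := sSup {d | ∃ a ∈ S, ∃ b ∈ S, d = dE a b}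

/-- Euclidean distance between two planar sets. -/
def distE (A B : Set (ℝ × ℝ)) : ℝ := sInf {d | ∃ a ∈ A, ∃ b ∈ B, d = dE a b}

/-- The function `q² √(det K_H)`. -/
def Qfun (k : ℝ) (q : ℝ × ℝ → ℝ) (x : ℝ × ℝ) : ℝ := q x ^ 2 * Real.sqrt (detKH k x)

/-- Surrogate for membership in `H(Ω) = H¹₀(Ω)` (with equivalent norm
`‖u‖² = ∫_Ω (K_H ∇u|∇u)`). -/
def MemH (k : ℝ) (Ω : Set (ℝ × ℝ)) (u : ℝ × ℝ → ℝ) : Prop :=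
  ContinuousOn u (closure Ω) ∧ ContDiffOn ℝ 1 u Ω ∧ (∀ x ∈ frontier Ω, u x = 0) ∧
    IntegrableOn (fun x => KHform k x (grad u x) (grad u x)) Ω

/-- The energy functional `I_ε`. -/
def Ieps (k p ε : ℝ) (q : ℝ × ℝ → ℝ) (Ω : Set (ℝ × ℝ)) (u : ℝ × ℝ → ℝ) : ℝ :=
  (1 / 2) * (∫ x in Ω, KHform k x (grad u x) (grad u x))
    - (1 / ((p + 1) * ε ^ 2)) * ∫ x in Ω, pPart (u x - q x * Real.log (1 / ε)) ^ (p + 1)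

/-- The mountain pass value `c_ε = inf_{γ ∈ P_ε} max_{t ∈ [0,1]} I_ε(γ(t))`, where
`P_ε` is the collection of paths in `H(Ω)` (continuous for the `H`-norm) joining `0`
to a point with negative energy. -/
def ceps (k p : ℝ) (q : ℝ × ℝ → ℝ) (Ω : Set (ℝ × ℝ)) (ε : ℝ) : ℝ :=
  sInf {c | ∃ γ : ℝ → ℝ × ℝ → ℝ,
    (∀ t ∈ Icc (0:ℝ) 1, MemH k Ω (γ t)) ∧
    (∀ t ∈ Icc (0:ℝ) 1, ∀ δ > 0, ∃ η > 0, ∀ s ∈ Icc (0:ℝ) 1, |s - t| < η →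
      (∫ x in Ω, KHform k x (grad (fun y => γ s y - γ t y) x)
        (grad (fun y => γ s y - γ t y) x)) < δ) ∧
    γ 0 = (fun _ => 0) ∧ Ieps k p ε q Ω (γ 1) < 0 ∧
    c = sSup ((fun t => Ieps k p ε q Ω (γ t)) '' Icc (0:ℝ) 1)}

/-- The Nehari manifold `N_ε`. -/
def Nehari (k p ε : ℝ) (q : ℝ × ℝ → ℝ) (Ω : Set (ℝ × ℝ)) : Set (ℝ × ℝ → ℝ) :=
  {u | MemH k Ω u ∧ ¬ Set.EqOn u 0 Ω ∧
    (∫ x in Ω, KHform k x (grad u x) (grad u x))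
      = (1 / ε ^ 2) * ∫ x in Ω, pPart (u x - q x * Real.log (1 / ε)) ^ p * u x}

/-- `u` is a (classical) solution of `L_H u = ε⁻²(u - q ln(1/ε))₊ᵖ` in `Ω`, `u = 0` on `∂Ω`. -/
def IsSolution (k p ε : ℝ) (q : ℝ × ℝ → ℝ) (Ω : Set (ℝ × ℝ)) (u : ℝ × ℝ → ℝ) : Prop :=
  ContinuousOn u (closure Ω) ∧ ContDiffOn ℝ 2 u Ω ∧ (∀ x ∈ frontier Ω, u x = 0) ∧
    ∀ x ∈ Ω, LH k u x = (1 / ε ^ 2) * pPart (u x - q x * Real.log (1 / ε)) ^ p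

/-- `u` is a mountain pass solution: a solution at the mountain pass level `c_ε`. -/
def IsMPSolution (k p ε : ℝ) (q : ℝ × ℝ → ℝ) (Ω : Set (ℝ × ℝ)) (u : ℝ × ℝ → ℝ) : Prop :=
  IsSolution k p ε q Ω u ∧ MemH k Ω u ∧ Ieps k p ε q Ω u = ceps k p q Ω ε

/-- The vortex core `A_ε = {x ∈ Ω : u(x) > q(x) ln(1/ε)}`. -/
def vcore (q : ℝ × ℝ → ℝ) (Ω : Set (ℝ × ℝ)) (ε : ℝ) (u : ℝ × ℝ → ℝ) : Set (ℝ × ℝ) :=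
  {x ∈ Ω | q x * Real.log (1 / ε) < u x}

lemma div_int_zero {F : ℝ × ℝ → ℝ} (hF : ContDiff ℝ 1 F) (hc : HasCompactSupport F) (v : ℝ × ℝ) :
    Integrable (fun x => fderiv ℝ F x v) ∧ ∫ x, fderiv ℝ F x v = 0 := by
  have hi : Integrable (fun x => fderiv ℝ F x v) :=
    Continuous.integrable_of_hasCompactSupport
      ((hF.continuous_fderiv (by simp)).clm_apply continuous_const) (hc.fderiv_apply (𝕜 := ℝ) v)
  refine ⟨hi, ?_⟩
  have h := integral_mul_fderiv_eq_neg_fderiv_mul_of_integrable (𝕜 := ℝ) (μ := (volume : Measure (ℝ × ℝ)))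
    (f := fun _ => (1:ℝ)) (g := F) (v := v) (by simp) (by simpa using hi)
    (by simpa using hF.continuous.integrable_of_hasCompactSupport hc)
    (by simp) (fun x _ => hF.differentiable (by simp) x)
  simpa using h

lemma ext_zero {Ω C : Set (ℝ × ℝ)} (hΩ : IsOpen Ω) (hC : IsCompact C) (hCΩ : C ⊆ Ω)
    {f : ℝ × ℝ → ℝ} (hf : ContDiffOn ℝ 1 f Ω) (hz : ∀ x ∈ Ω, x ∉ C → f x = 0) (v : ℝ × ℝ) :
    IntegrableOn (fun x => fderiv ℝ f x v) Ω ∧ ∫ x in Ω, fderiv ℝ f x v = 0 := by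
  classical
  set F : ℝ × ℝ → ℝ := Ω.indicator f with hFd
  have hFz : ∀ x, x ∉ C → F x = 0 := by
    intro x hx
    by_cases h : x ∈ Ω
    · rw [hFd, indicator_of_mem h]; exact hz x h hx
    · rw [hFd, indicator_of_notMem h]
  have heq : ∀ x ∈ Ω, F =ᶠ[𝓝 x] f := by
    intro x hx
    filter_upwards [hΩ.mem_nhds hx] with y hy
    rw [hFd, indicator_of_mem hy]
  have heq0 : ∀ x, x ∉ C → F =ᶠ[𝓝 x] fun _ => 0 := by
    intro x hx
    filter_upwards [hC.isClosed.isOpen_compl.mem_nhds hx] with y hy using hFz y hy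
  have hF : ContDiff ℝ 1 F := by
    rw [contDiff_iff_contDiffAt]
    intro x
    by_cases h : x ∈ Ω
    · exact (hf.contDiffAt (hΩ.mem_nhds h)).congr_of_eventuallyEq (heq x h)
    · exact contDiffAt_const.congr_of_eventuallyEq (heq0 x fun h' => h (hCΩ h'))
  have hFc : HasCompactSupport F := HasCompactSupport.intro hC hFz
  obtain ⟨h1, h2⟩ := div_int_zero hF hFc v
  have hon : EqOn (fun x => fderiv ℝ F x v) (fun x => fderiv ℝ f x v) Ω := by
    intro x hx
    simp only [(heq x hx).fderiv_eq]
  constructor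
  · exact h1.integrableOn.congr_fun hon hΩ.measurableSet
  · rw [← setIntegral_congr_fun hΩ.measurableSet hon, ← h2]
    apply setIntegral_eq_integral_of_forall_compl_eq_zero
    intro x hx
    rw [(heq0 x fun h' => hx (hCΩ h')).fderiv_eq]
    simp

lemma ibp {Ω C : Set (ℝ × ℝ)} (hΩ : IsOpen Ω) (hC : IsCompact C) (hCΩ : C ⊆ Ω)
    {v G1 G2 : ℝ × ℝ → ℝ} {Ψ : ℝ → ℝ} (hv : ContDiffOn ℝ 1 v Ω)
    (hG1 : ContDiffOn ℝ 1 G1 Ω) (hG2 : ContDiffOn ℝ 1 G2 Ω) (hΨ : ContDiff ℝ 1 Ψ)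
    (hz : ∀ x ∈ Ω, x ∉ C → Ψ (v x) = 0) (D : ℝ × ℝ → ℝ)
    (hD : ∀ x ∈ Ω, D x = deriv Ψ (v x) * (fderiv ℝ v x (1,0) * G1 x + fderiv ℝ v x (0,1) * G2 x)
      + Ψ (v x) * (fderiv ℝ G1 x (1,0) + fderiv ℝ G2 x (0,1))) :
    IntegrableOn D Ω ∧ ∫ x in Ω, D x = 0 := by
  have hc : ContDiffOn ℝ 1 (fun x => Ψ (v x)) Ω := hΨ.comp_contDiffOn hv
  obtain ⟨a1, a2⟩ := ext_zero hΩ hC hCΩ (hc.mul hG1)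
    (fun x hx hxC => by simp [hz x hx hxC]) (1,0)
  obtain ⟨b1, b2⟩ := ext_zero hΩ hC hCΩ (hc.mul hG2)
    (fun x hx hxC => by simp [hz x hx hxC]) (0,1)
  have key : ∀ (G : ℝ × ℝ → ℝ), ContDiffOn ℝ 1 G Ω → ∀ x ∈ Ω, ∀ e,
      fderiv ℝ (fun x => Ψ (v x) * G x) x e
      = deriv Ψ (v x) * (fderiv ℝ v x e * G x) + Ψ (v x) * fderiv ℝ G x e := by
    intro G hG x hx e
    have hvx : DifferentiableAt ℝ v x :=
      (hv.contDiffAt (hΩ.mem_nhds hx)).differentiableAt (by simp)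
    have hGx : DifferentiableAt ℝ G x :=
      (hG.contDiffAt (hΩ.mem_nhds hx)).differentiableAt (by simp)
    have h1 : HasFDerivAt (fun x => Ψ (v x)) (deriv Ψ (v x) • fderiv ℝ v x) x :=
      ((hΨ.differentiable (by simp)) (v x)).hasDerivAt.comp_hasFDerivAt x hvx.hasFDerivAt
    have h2 := (h1.mul hGx.hasFDerivAt).fderiv
    change fderiv ℝ (fun x => Ψ (v x) * G x) x = _ at h2
    rw [h2]
    simp
    ring
  have hon : EqOn (fun x => fderiv ℝ (fun x => Ψ (v x) * G1 x) x (1,0)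
      + fderiv ℝ (fun x => Ψ (v x) * G2 x) x (0,1)) D Ω := by
    intro x hx
    simp only [key G1 hG1 x hx, key G2 hG2 x hx, hD x hx]
    ring
  constructor
  · exact (a1.add b1).congr_fun hon hΩ.measurableSet
  · rw [← setIntegral_congr_fun hΩ.measurableSet hon, integral_add a1 b1, a2, b2, add_zero]

/-- cut-off profile -/
def psiN (s t : ℝ) (n : ℕ) (r : ℝ) : ℝ := max 0 (min 1 ((n + 1 : ℝ) * min (r - s) (t - r) - 1))

lemma psiN_cont (s t : ℝ) (n : ℕ) : Continuous (psiN s t n) := by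
  unfold psiN; fun_prop

lemma psiN_nonneg (s t : ℝ) (n : ℕ) (r : ℝ) : 0 ≤ psiN s t n r := le_max_left _ _

lemma psiN_le_one (s t : ℝ) (n : ℕ) (r : ℝ) : psiN s t n r ≤ 1 :=
  max_le zero_le_one (min_le_left _ _)

lemma psiN_zero_left (s t : ℝ) (n : ℕ) (r : ℝ) (h : r ≤ s + 1 / (n + 1 : ℝ)) :
    psiN s t n r = 0 := by
  unfold psiN
  apply max_eq_left
  refine (min_le_right _ _).trans ?_
  have hn : (0:ℝ) < n + 1 := by positivity
  have h1 : (n + 1 : ℝ) * min (r - s) (t - r) ≤ (n + 1 : ℝ) * (1 / (n + 1 : ℝ)) :=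
    mul_le_mul_of_nonneg_left ((min_le_left _ _).trans (by linarith)) hn.le
  rw [mul_one_div_cancel hn.ne'] at h1
  linarith

lemma psiN_zero_right (s t : ℝ) (n : ℕ) (r : ℝ) (h : t ≤ r) : psiN s t n r = 0 := by
  unfold psiN
  apply max_eq_left
  refine (min_le_right _ _).trans ?_
  have hn : (0:ℝ) < n + 1 := by positivity
  have h1 : (n + 1 : ℝ) * min (r - s) (t - r) ≤ (n + 1 : ℝ) * 0 :=
    mul_le_mul_of_nonneg_left ((min_le_right _ _).trans (by linarith)) hn.le
  linarith

lemma psiN_mono (s t r : ℝ) : Monotone (fun n => psiN s t n r) := by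
  intro m n hmn
  by_cases h : s < r ∧ r < t
  · have h0 : 0 ≤ min (r - s) (t - r) := le_min (by linarith [h.1]) (by linarith [h.2])
    have : (m:ℝ) ≤ n := by exact_mod_cast hmn
    simp only [psiN]
    gcongr
  · have : psiN s t m r = 0 := by
      by_cases h1 : s < r
      · exact psiN_zero_right s t m r (by by_contra h2; exact h ⟨h1, not_le.1 h2⟩)
      · exact psiN_zero_left s t m r (by have : (0:ℝ) < 1 / (m + 1 : ℝ) := by positivity
                                         linarith)
    simp only [this]
    exact psiN_nonneg _ _ _ _

lemma psiN_tendsto (s t r : ℝ) :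
    Tendsto (fun n => psiN s t n r) atTop (𝓝 ((Ioo s t).indicator (fun _ => (1:ℝ)) r)) := by
  by_cases h : r ∈ Ioo s t
  · rw [indicator_of_mem h]
    have h0 : 0 < min (r - s) (t - r) := lt_min (by linarith [h.1]) (by linarith [h.2])
    apply tendsto_const_nhds.congr'
    obtain ⟨N, hN⟩ := exists_nat_gt (2 / min (r - s) (t - r))
    filter_upwards [eventually_ge_atTop N] with n hn
    have hn' : (N:ℝ) ≤ n := by exact_mod_cast hn
    have : 2 < (n + 1 : ℝ) * min (r - s) (t - r) := by
      rw [← div_lt_iff₀ h0]; linarith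
    unfold psiN
    rw [min_eq_left (by linarith), max_eq_right zero_le_one]
  · rw [indicator_of_notMem h]
    apply tendsto_const_nhds.congr
    intro n
    by_cases h1 : s < r
    · exact (psiN_zero_right s t n r (by by_contra h2; exact h ⟨h1, not_le.1 h2⟩)).symm
    · exact (psiN_zero_left s t n r (by have : (0:ℝ) < 1 / (n + 1 : ℝ) := by positivity
                                        linarith)).symm

/-- primitive of the cut-off profile -/
def PsiN (s t : ℝ) (n : ℕ) (r : ℝ) : ℝ := ∫ y in s..r, psiN s t n y

lemma PsiN_hasDeriv (s t : ℝ) (n : ℕ) (r : ℝ) : HasDerivAt (PsiN s t n) (psiN s t n r) r :=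
  intervalIntegral.integral_hasDerivAt_right ((psiN_cont s t n).intervalIntegrable _ _)
    (psiN_cont s t n).aestronglyMeasurable.stronglyMeasurableAtFilter (psiN_cont s t n).continuousAt

lemma PsiN_deriv (s t : ℝ) (n : ℕ) : deriv (PsiN s t n) = psiN s t n :=
  funext fun r => (PsiN_hasDeriv s t n r).deriv

lemma PsiN_contDiff (s t : ℝ) (n : ℕ) : ContDiff ℝ 1 (PsiN s t n) := by
  rw [contDiff_one_iff_deriv, PsiN_deriv]
  exact ⟨fun r => (PsiN_hasDeriv s t n r).differentiableAt, psiN_cont s t n⟩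

lemma PsiN_zero (s t : ℝ) (n : ℕ) (r : ℝ) (h : r ≤ s + 1 / (n + 1 : ℝ)) : PsiN s t n r = 0 := by
  unfold PsiN
  have h0 : (0:ℝ) < 1 / (n + 1 : ℝ) := by positivity
  rw [intervalIntegral.integral_congr (g := fun _ => (0:ℝ))]
  · simp
  · intro y hy
    apply psiN_zero_left
    rw [mem_uIcc] at hy
    rcases hy with hy | hy <;> linarith [hy.1, hy.2]

lemma PsiN_const (s t : ℝ) (n : ℕ) (r : ℝ) (h : t ≤ r) : PsiN s t n r = PsiN s t n t := by
  unfold PsiN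
  rw [← intervalIntegral.integral_add_adjacent_intervals
    ((psiN_cont s t n).intervalIntegrable s t) ((psiN_cont s t n).intervalIntegrable t r)]
  rw [intervalIntegral.integral_congr (a := t) (b := r) (g := fun _ => (0:ℝ))]
  · simp
  · intro y hy
    apply psiN_zero_right
    rw [uIcc_of_le h] at hy
    exact hy.1

lemma PsiN_tendsto (s t : ℝ) (h : s ≤ t) :
    Tendsto (fun n => PsiN s t n t) atTop (𝓝 (t - s)) := by
  have h1 : ∫ y in s..t, (Ioo s t).indicator (fun _ => (1:ℝ)) y = t - s := by
    rw [intervalIntegral.integral_of_le h, setIntegral_indicator measurableSet_Ioo,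
      inter_eq_right.2 Ioo_subset_Ioc_self]
    simp [h]
  rw [← h1]
  unfold PsiN
  apply intervalIntegral.tendsto_integral_filter_of_dominated_convergence (fun _ => (1:ℝ))
  · exact Eventually.of_forall fun n => (psiN_cont s t n).aestronglyMeasurable
  · refine Eventually.of_forall fun n => Eventually.of_forall fun y _ => ?_
    rw [Real.norm_of_nonneg (psiN_nonneg _ _ _ _)]
    exact psiN_le_one _ _ _ _
  · simp
  · exact Eventually.of_forall fun y _ => psiN_tendsto s t y

lemma KH_cd {Ω : Set (ℝ × ℝ)} (hΩ : IsOpen Ω) {k : ℝ} (hk : 0 < k) {u : ℝ × ℝ → ℝ}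
    (hu : ContDiffOn ℝ 2 u Ω) :
    ContDiffOn ℝ 1 (fun y => (KHvec k y (grad u y)).1) Ω ∧
    ContDiffOn ℝ 1 (fun y => (KHvec k y (grad u y)).2) Ω := by
  have hf : ContDiffOn ℝ 1 (fderiv ℝ u) Ω := hu.fderiv_of_isOpen hΩ (by norm_num)
  have h1 : ContDiffOn ℝ 1 (fun y => fderiv ℝ u y (1,0)) Ω := hf.clm_apply contDiffOn_const
  have h2 : ContDiffOn ℝ 1 (fun y => fderiv ℝ u y (0,1)) Ω := hf.clm_apply contDiffOn_const
  have hx1 : ContDiffOn ℝ 1 (fun y : ℝ × ℝ => y.1) Ω := contDiff_fst.contDiffOn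
  have hx2 : ContDiffOn ℝ 1 (fun y : ℝ × ℝ => y.2) Ω := contDiff_snd.contDiffOn
  have hinv : ContDiffOn ℝ 1 (fun y : ℝ × ℝ => (k ^ 2 + y.1 ^ 2 + y.2 ^ 2)⁻¹) Ω := by
    apply ContDiffOn.inv
    · exact (contDiffOn_const.add (hx1.pow 2)).add (hx2.pow 2)
    · intro x _; positivity
  constructor
  · exact hinv.mul (((contDiffOn_const.add (hx2.pow 2)).mul h1).sub ((hx1.mul hx2).mul h2))
  · exact hinv.mul (((hx1.mul hx2).neg.mul h1).add ((contDiffOn_const.add (hx1.pow 2)).mul h2))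

lemma fderiv_quot {q u : ℝ × ℝ → ℝ} {x : ℝ × ℝ} (hu : DifferentiableAt ℝ u x)
    (hq : DifferentiableAt ℝ q x) (h0 : q x ≠ 0) (e : ℝ × ℝ) :
    fderiv ℝ (fun y => u y / q y) x e
      = (q x * fderiv ℝ u x e - u x * fderiv ℝ q x e) / q x ^ 2 := by
  have h := (hu.hasFDerivAt.mul ((hasDerivAt_inv h0).comp_hasFDerivAt x hq.hasFDerivAt)).fderiv
  have : (fun y => u y / q y) = u * (Inv.inv ∘ q) := by
    funext y; simp [div_eq_mul_inv]
  rw [this, h]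
  simp
  field_simp
  ring

lemma KHform_nonneg {k : ℝ} (hk : 0 < k) (x a : ℝ × ℝ) : 0 ≤ KHform k x a a := by
  unfold KHform
  apply mul_nonneg (by positivity)
  nlinarith [sq_nonneg (x.2 * a.1 - x.1 * a.2), sq_nonneg (k * a.1), sq_nonneg (k * a.2)]

lemma core (k p ε s t : ℝ) (hk : 0 < k) (hp : 1 < p) (hs : 0 ≤ s) (hst : s < t)
    (ht : t ≤ Real.log (1 / ε))
    (Ω : Set (ℝ × ℝ)) (hΩo : IsOpen Ω) (hΩb : Bornology.IsBounded Ω)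
    (q : ℝ × ℝ → ℝ) (hq1 : ContDiffOn ℝ 2 q Ω) (hq2 : ContinuousOn q (closure Ω))
    (hq3 : ∀ x ∈ closure Ω, 0 < q x) (hq4 : ∀ x ∈ Ω, LH k q x = 0)
    (u : ℝ × ℝ → ℝ) (hu : IsSolution k p ε q Ω u) :
    ∫ x in Ω, (Ioo s t).indicator (fun _ => (1:ℝ)) (u x / q x) *
      (q x ^ 2 * KHform k x (grad (fun y => u y / q y) x) (grad (fun y => u y / q y) x))
    = (t - s) * ((1 / ε ^ 2) *
      (∫ x in Ω, pPart (u x - q x * Real.log (1 / ε)) ^ p * q x)) := by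
  obtain ⟨hu1, hu2, hu3, hu4⟩ := hu
  have hcl : ∀ x ∈ Ω, x ∈ closure Ω := fun x hx => subset_closure hx
  have hq0 : ∀ x ∈ Ω, q x ≠ 0 := fun x hx => (hq3 x (hcl x hx)).ne'
  have hcomp : IsCompact (closure Ω) := hΩb.isCompact_closure
  set v : ℝ × ℝ → ℝ := fun y => u y / q y with hv
  set G1 : ℝ × ℝ → ℝ := fun x =>
    q x * (KHvec k x (grad u x)).1 - u x * (KHvec k x (grad q x)).1 with hG1
  set G2 : ℝ × ℝ → ℝ := fun x =>
    q x * (KHvec k x (grad u x)).2 - u x * (KHvec k x (grad q x)).2 with hG2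
  obtain ⟨ku1, ku2⟩ := KH_cd hΩo hk hu2
  obtain ⟨kq1, kq2⟩ := KH_cd hΩo hk hq1
  have hq11 : ContDiffOn ℝ 1 q Ω := hq1.of_le (by norm_num)
  have hu11 : ContDiffOn ℝ 1 u Ω := hu2.of_le (by norm_num)
  have hv1 : ContDiffOn ℝ 1 v Ω := hu11.div hq11 hq0
  have cG1 : ContDiffOn ℝ 1 G1 Ω := (hq11.mul ku1).sub (hu11.mul kq1)
  have cG2 : ContDiffOn ℝ 1 G2 Ω := (hq11.mul ku2).sub (hu11.mul kq2)
  have dif : ∀ {f : ℝ × ℝ → ℝ}, ContDiffOn ℝ 1 f Ω → ∀ x ∈ Ω, DifferentiableAt ℝ f x :=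
    fun hf x hx => (hf.contDiffAt (hΩo.mem_nhds hx)).differentiableAt (by simp)
  set g : ℝ × ℝ → ℝ := fun x => q x ^ 2 * KHform k x (grad v x) (grad v x) with hg
  have hg0 : ∀ x, 0 ≤ g x := fun x => mul_nonneg (sq_nonneg _) (KHform_nonneg hk _ _)
  have hgG : ∀ x ∈ Ω, g x = fderiv ℝ v x (1,0) * G1 x + fderiv ℝ v x (0,1) * G2 x := by
    intro x hx
    have e := fderiv_quot (dif hu11 x hx) (dif hq11 x hx) (hq0 x hx)
    have h0 := hq0 x hx
    have hk0 : k ^ 2 + x.1 ^ 2 + x.2 ^ 2 ≠ 0 := by positivity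
    simp only [hg, hG1, hG2, grad, KHform, KHvec, hv, e]
    field_simp
    ring
  set I0 : ℝ × ℝ → ℝ := fun x => (1 / ε ^ 2) * (pPart (u x - q x * Real.log (1 / ε)) ^ p * q x)
    with hI0
  have hdiv : ∀ x ∈ Ω, fderiv ℝ G1 x (1,0) + fderiv ℝ G2 x (0,1) = - I0 x := by
    intro x hx
    have a1 := (((dif hq11 x hx).hasFDerivAt.mul (dif ku1 x hx).hasFDerivAt).sub
      ((dif hu11 x hx).hasFDerivAt.mul (dif kq1 x hx).hasFDerivAt)).fderiv
    have a2 := (((dif hq11 x hx).hasFDerivAt.mul (dif ku2 x hx).hasFDerivAt).sub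
      ((dif hu11 x hx).hasFDerivAt.mul (dif kq2 x hx).hasFDerivAt)).fderiv
    change fderiv ℝ G1 x = _ at a1
    change fderiv ℝ G2 x = _ at a2
    have b1 := hu4 x hx
    have b2 := hq4 x hx
    have hI : I0 x = q x * LH k u x - u x * LH k q x := by
      rw [b1, b2]; simp only [hI0]; ring
    rw [hI, a1, a2]
    simp only [LH, div2]
    simp only [ContinuousLinearMap.sub_apply, ContinuousLinearMap.add_apply,
      ContinuousLinearMap.smul_apply, smul_eq_mul]
    simp only [KHvec, grad]
    ring
  have cI0 : ContinuousOn I0 (closure Ω) := by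
    apply continuousOn_const.mul
    refine ContinuousOn.mul ?_ hq2
    apply ContinuousOn.rpow_const
    · have h1 : ContinuousOn (fun x => u x - q x * Real.log (1 / ε)) (closure Ω) :=
        hu1.sub (hq2.mul continuousOn_const)
      exact ContinuousOn.sup h1 continuousOn_const
    · intro x _; right; linarith
  have iI0 : IntegrableOn I0 Ω := (cI0.integrableOn_compact hcomp).mono_set subset_closure
  have nI0 : ∀ x ∈ Ω, 0 ≤ I0 x := by
    intro x hx
    have := hq3 x (hcl x hx)
    have : 0 ≤ pPart (u x - q x * Real.log (1 / ε)) := le_max_right _ _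
    simp only [hI0]
    positivity
  have hstep : ∀ n : ℕ, IntegrableOn (fun x => psiN s t n (v x) * g x) Ω ∧
      ∫ x in Ω, psiN s t n (v x) * g x = PsiN s t n t * ∫ x in Ω, I0 x := by
    intro n
    set δ : ℝ := s + 1 / (n + 1 : ℝ) with hδ
    have hδ0 : 0 < δ := by positivity
    set C : Set (ℝ × ℝ) := closure Ω ∩ {x | δ * q x - u x ≤ 0}
    have hCc : IsCompact C := by
      refine hcomp.of_isClosed_subset ?_ inter_subset_left
      exact ((continuousOn_const.mul hq2).sub hu1).preimage_isClosed_of_isClosed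
        isClosed_closure isClosed_Iic
    have hCΩ : C ⊆ Ω := by
      rintro x ⟨hx1, hx2⟩
      by_contra hx
      have hfr : x ∈ frontier Ω := by
        rw [hΩo.frontier_eq]; exact ⟨hx1, hx⟩
      have := hu3 x hfr
      have h2 := mul_pos hδ0 (hq3 x hx1)
      simp only [mem_setOf_eq] at hx2
      linarith
    have hz : ∀ x ∈ Ω, x ∉ C → PsiN s t n (v x) = 0 := by
      intro x hx hxC
      apply PsiN_zero
      have : ¬ (δ * q x - u x ≤ 0) := fun h => hxC ⟨hcl x hx, h⟩
      simp only [hv]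
      rw [div_le_iff₀ (hq3 x (hcl x hx))]
      linarith
    obtain ⟨h1, h2⟩ := ibp hΩo hCc hCΩ hv1 cG1 cG2 (PsiN_contDiff s t n) hz
      (fun x => psiN s t n (v x) * g x - PsiN s t n t * I0 x) (by
        intro x hx
        rw [hdiv x hx, ← hgG x hx, PsiN_deriv]
        by_cases hI : I0 x = 0
        · simp [hI]
        · have : t ≤ v x := by
            by_contra hlt
            apply hI
            have : u x - q x * Real.log (1 / ε) ≤ 0 := by
              have hqx := hq3 x (hcl x hx)
              have h3 : u x / q x ≤ Real.log (1 / ε) := by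
                simp only [hv] at hlt
                linarith
              rw [div_le_iff₀ hqx] at h3
              linarith
            simp only [hI0, pPart]
            rw [max_eq_right this, Real.zero_rpow (by linarith)]
            simp
          rw [PsiN_const s t n (v x) this]
          ring)
    have h3 : IntegrableOn (fun x => psiN s t n (v x) * g x) Ω := by
      refine (h1.add (iI0.const_mul (PsiN s t n t))).congr ?_
      exact Eventually.of_forall fun x => by simp
    refine ⟨h3, ?_⟩
    rw [integral_sub h3 (iI0.const_mul _), integral_const_mul] at h2
    linarith
  have cg : ContinuousOn g Ω := by
    have hf : ContinuousOn (fderiv ℝ v) Ω := hv1.continuousOn_fderiv_of_isOpen hΩo (by simp)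
    exact (((hf.clm_apply continuousOn_const).mul cG1.continuousOn).add
      ((hf.clm_apply continuousOn_const).mul cG2.continuousOn)).congr hgG
  have hPn : ∀ n, 0 ≤ PsiN s t n t := fun n =>
    intervalIntegral.integral_nonneg hst.le fun y _ => psiN_nonneg _ _ _ _
  have hI0n : 0 ≤ ∫ x in Ω, I0 x := setIntegral_nonneg hΩo.measurableSet nI0
  have lim1 : Tendsto (fun n => ∫⁻ x in Ω, ENNReal.ofReal (psiN s t n (v x) * g x)) atTop
      (𝓝 (∫⁻ x in Ω, ENNReal.ofReal ((Ioo s t).indicator (fun _ => (1:ℝ)) (v x) * g x))) := by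
    apply lintegral_tendsto_of_tendsto_of_monotone
    · intro n
      exact (hstep n).1.aestronglyMeasurable.aemeasurable.ennreal_ofReal
    · refine Eventually.of_forall fun x m n hmn => ?_
      exact ENNReal.ofReal_le_ofReal (mul_le_mul_of_nonneg_right (psiN_mono s t (v x) hmn) (hg0 x))
    · refine Eventually.of_forall fun x => ?_
      exact (ENNReal.continuous_ofReal.tendsto _).comp ((psiN_tendsto s t (v x)).mul_const _)
  have lim2 : Tendsto (fun n => ∫⁻ x in Ω, ENNReal.ofReal (psiN s t n (v x) * g x)) atTop
      (𝓝 (ENNReal.ofReal ((t - s) * ∫ x in Ω, I0 x))) := by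
    have : ∀ n, ∫⁻ x in Ω, ENNReal.ofReal (psiN s t n (v x) * g x)
        = ENNReal.ofReal (PsiN s t n t * ∫ x in Ω, I0 x) := by
      intro n
      rw [← (hstep n).2, ofReal_integral_eq_lintegral_ofReal (hstep n).1]
      exact Eventually.of_forall fun x => mul_nonneg (psiN_nonneg _ _ _ _) (hg0 x)
    simp only [this]
    exact (ENNReal.continuous_ofReal.tendsto _).comp ((PsiN_tendsto s t hst.le).mul_const _)
  have heq := tendsto_nhds_unique lim1 lim2
  have hmeas : AEStronglyMeasurable (fun x => (Ioo s t).indicator (fun _ => (1:ℝ)) (v x) * g x)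
      (volume.restrict Ω) := by
    refine AEStronglyMeasurable.mul ?_ (cg.aestronglyMeasurable hΩo.measurableSet)
    have hvm : AEMeasurable v (volume.restrict Ω) :=
      hv1.continuousOn.aemeasurable hΩo.measurableSet
    exact ((measurable_const.indicator measurableSet_Ioo).comp_aemeasurable
      hvm).aestronglyMeasurable
  have hfin : ∫ x in Ω, (Ioo s t).indicator (fun _ => (1:ℝ)) (v x) * g x
      = (t - s) * ∫ x in Ω, I0 x := by
    rw [integral_eq_lintegral_of_nonneg_ae _ hmeas, heq, ENNReal.toReal_ofReal]
    · exact mul_nonneg (by linarith) hI0n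
    · refine Eventually.of_forall fun x => mul_nonneg (indicator_nonneg (by simp) _) (hg0 x)
  rw [← integral_const_mul]
  exact hfin

/-- identity (3.16): for `0 < τ < σ ≤ 1` and `ε ≤ τ`, the truncated
function `w^{σ,τ}_ε = min((u_ε - q ln(1/σ))₊/(q ln(σ/τ)), 1)` satisfies
`ln(σ/τ) ∫_Ω q² (K_H ∇w|∇w) = ε⁻² ∫_Ω (u_ε - q ln(1/ε))₊ᵖ q`; moreover `w ≡ 1` on
`A_ε^τ` and its support (within `Ω`) is the closure of `A_ε^σ`. -/
theorem statement18 (k p ε σ τ : ℝ) (hk : 0 < k) (hp : 1 < p)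
    (hε : 0 < ε) (hετ : ε ≤ τ) (hτσ : τ < σ) (hτ : 0 < τ) (hσ : σ ≤ 1)
    (Ω : Set (ℝ × ℝ)) (hΩo : IsOpen Ω) (hΩc : IsConnected Ω)
    (hΩb : Bornology.IsBounded Ω) (hΩsc : SimplyConnectedSpace ↥Ω)
    (q : ℝ × ℝ → ℝ) (hq1 : ContDiffOn ℝ 2 q Ω) (hq2 : ContDiffOn ℝ 1 q (closure Ω))
    (hq3 : ∀ x ∈ closure Ω, 0 < q x) (hq4 : ∀ x ∈ Ω, LH k q x = 0)
    (u : ℝ × ℝ → ℝ) (hu : IsSolution k p ε q Ω u) (huH : MemH k Ω u) :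
    ∀ wst : ℝ × ℝ → ℝ,
      (∀ x, wst x
        = min (pPart (u x - q x * Real.log (1 / σ)) / (q x * Real.log (σ / τ))) 1) →
      Real.log (σ / τ) * (∫ x in Ω, q x ^ 2 * KHform k x (grad wst x) (grad wst x))
          = (1 / ε ^ 2) * (∫ x in Ω, pPart (u x - q x * Real.log (1 / ε)) ^ p * q x) ∧
      (∀ x ∈ {x ∈ Ω | q x * Real.log (1 / τ) < u x}, wst x = 1) ∧
      closure {x ∈ Ω | wst x ≠ 0}
        = closure {x ∈ Ω | q x * Real.log (1 / σ) < u x} := by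
  intro w hw
  have hσ0 : 0 < σ := hτ.trans hτσ
  have hcl : ∀ x ∈ Ω, x ∈ closure Ω := fun x hx => subset_closure hx
  have hqp : ∀ x ∈ Ω, 0 < q x := fun x hx => hq3 x (hcl x hx)
  have hlog : Real.log (σ / τ) = Real.log (1 / τ) - Real.log (1 / σ) := by
    rw [Real.log_div hσ0.ne' hτ.ne', one_div, one_div, Real.log_inv, Real.log_inv]; ring
  have hT : 0 < Real.log (σ / τ) := Real.log_pos (by rw [lt_div_iff₀ hτ]; linarith)
  have hs : 0 ≤ Real.log (1 / σ) := Real.log_nonneg (by rw [le_div_iff₀ hσ0]; linarith)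
  have htε : Real.log (1 / τ) ≤ Real.log (1 / ε) :=
    Real.log_le_log (by positivity) (one_div_le_one_div_of_le hε hετ)
  set s := Real.log (1 / σ) with hsd
  set t := Real.log (1 / τ) with htd
  rw [hlog] at hT
  simp only [hlog] at hw ⊢
  have hcore := core k p ε s t hk hp hs (by linarith) htε Ω hΩo hΩb q hq1 hq2.continuousOn
    hq3 hq4 u hu
  have hw' : ∀ x ∈ Ω, w x = min (max (u x / q x - s) 0 / (t - s)) 1 := by
    intro x hx
    have h := hqp x hx
    rw [hw x, pPart]
    congr 1
    have : max (u x - q x * s) 0 = q x * max (u x / q x - s) 0 := by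
      rw [mul_max_of_nonneg _ _ h.le, mul_zero, mul_sub, mul_div_cancel₀ _ h.ne']
    rw [this, mul_div_mul_left _ _ h.ne']
  have hvc : ContinuousOn (fun y => u y / q y) Ω :=
    (hu.1.mono subset_closure).div (hq1.continuousOn) fun x hx => (hqp x hx).ne'
  have hvd : ∀ x ∈ Ω, DifferentiableAt ℝ (fun y => u y / q y) x := by
    intro x hx
    have h1 : DifferentiableAt ℝ u x :=
      (hu.2.1.contDiffAt (hΩo.mem_nhds hx)).differentiableAt (by norm_num)
    have h2 : DifferentiableAt ℝ q x :=
      (hq1.contDiffAt (hΩo.mem_nhds hx)).differentiableAt (by norm_num)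
    simp only [div_eq_mul_inv]
    exact h1.mul (h2.inv (hqp x hx).ne')
  set v : ℝ × ℝ → ℝ := fun y => u y / q y with hv
  have hvat : ∀ x ∈ Ω, ContinuousAt v x := fun x hx => hvc.continuousAt (hΩo.mem_nhds hx)
  have hfd : ∀ x ∈ Ω, fderiv ℝ w x
      = ((Ioo s t).indicator (fun _ => (1:ℝ)) (v x) / (t - s)) • fderiv ℝ v x := by
    intro x hx
    have hΩx := hΩo.mem_nhds hx
    by_cases h : v x ∈ Ioo s t
    · rw [indicator_of_mem h]
      have he : w =ᶠ[𝓝 x] fun y => (t - s)⁻¹ * (v y - s) := by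
        filter_upwards [hΩx, (hvat x hx).eventually (isOpen_Ioo.mem_nhds h)] with y hy hy2
        rw [hw' y hy]
        change min (max (v y - s) 0 / (t - s)) 1 = _
        rw [max_eq_left (by linarith [hy2.1]), min_eq_left]
        · rw [div_eq_inv_mul]
        · rw [div_le_one hT]; linarith [hy2.2]
      rw [he.fderiv_eq]
      rw [(((hvd x hx).hasFDerivAt.sub_const s).const_mul (t - s)⁻¹).fderiv, one_div]
    · rw [indicator_of_notMem h, zero_div, zero_smul]
      by_cases h1 : s < v x
      · have h2 : t ≤ v x := by by_contra h2; exact h ⟨h1, not_le.1 h2⟩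
        apply IsLocalMax.fderiv_eq_zero
        have hx1 : w x = 1 := by
          rw [hw' x hx]
          change min (max (v x - s) 0 / (t - s)) 1 = _
          apply min_eq_right
          rw [le_div_iff₀ hT]
          exact le_max_of_le_left (by linarith)
        refine Eventually.of_forall fun y => ?_
        rw [hx1, hw y]
        exact min_le_right _ _
      · apply IsLocalMin.fderiv_eq_zero
        have hx1 : w x = 0 := by
          rw [hw' x hx]
          change min (max (v x - s) 0 / (t - s)) 1 = _
          rw [max_eq_right (by linarith)]
          simp
        filter_upwards [hΩx] with y hy
        rw [hx1, hw' y hy]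
        exact le_min (div_nonneg (le_max_right _ _) hT.le) zero_le_one
  refine ⟨?_, ?_, ?_⟩
  · have hint : ∫ x in Ω, q x ^ 2 * KHform k x (grad w x) (grad w x)
        = ∫ x in Ω, ((t - s)⁻¹ ^ 2) * ((Ioo s t).indicator (fun _ => (1:ℝ)) (v x) *
          (q x ^ 2 * KHform k x (grad v x) (grad v x))) := by
      apply setIntegral_congr_fun hΩo.measurableSet
      intro x hx
      simp only [grad, hfd x hx]
      by_cases h : v x ∈ Ioo s t
      · simp only [indicator_of_mem h, KHform, ContinuousLinearMap.smul_apply, smul_eq_mul]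
        field_simp
      · simp [indicator_of_notMem h, KHform]
    rw [hint, integral_const_mul]
    change ∫ x in Ω, (Ioo s t).indicator (fun _ => (1:ℝ)) (v x) *
          (q x ^ 2 * KHform k x (grad v x) (grad v x)) = _ at hcore
    rw [hcore]
    generalize (∫ x in Ω, pPart (u x - q x * Real.log (1 / ε)) ^ p * q x) = J
    field_simp
  · rintro x ⟨hx, hx2⟩
    rw [hw' x hx]
    apply min_eq_right
    have h := hqp x hx
    rw [le_div_iff₀ hT]
    apply le_max_of_le_left
    have : t ≤ u x / q x := by rw [le_div_iff₀ h]; linarith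
    linarith
  · congr 1
    ext x
    simp only [mem_setOf_eq]
    refine and_congr_right fun hx => ?_
    have h := hqp x hx
    rw [hw' x hx]
    have hiff : q x * s < u x ↔ 0 < u x / q x - s := by
      rw [sub_pos, lt_div_iff₀ h, mul_comm]
    rw [hiff]
    constructor
    · intro hne
      by_contra hle
      apply hne
      rw [max_eq_right (by linarith)]
      simp
    · intro hpos
      apply ne_of_gt
      exact lt_min (div_pos (lt_max_of_lt_left hpos) hT) one_pos
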